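/- For d ≥ 2, κ_i ≥ 0 (i = 1,…,d+1) and n ∈ ℕ_0: every polynomial f in d variables of degree at most n satisfies ‖ √((1−|x|)/|x|) ⟨x,∇⟩f ‖_{κ,2} ≤ √(n(n+|κ|+d)) ‖f‖_{κ,2}, and this inequality is sharp: there exists a nonzero polynomial f of degree exactly n for which equality holds. -/

import Mathlib

open MeasureTheory Finset

noncomputable section

/-- The simplex `△^d = {x : x_i ≥ 0, x_1 + ⋯ + x_d ≤ 1}`. -/
def Splx (d : ℕ) : Set (Fin d → ℝ) := {x | (∀ i, 0 ≤ x i) ∧ ∑ i, x i ≤ 1}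

/-- The `i`-th partial derivative. -/
def pd {d : ℕ} (i : Fin d) (f : (Fin d → ℝ) → ℝ) : (Fin d → ℝ) → ℝ :=
  fun x => fderiv ℝ f x (Pi.single i 1)

/-- `∂_{i,j} = ∂_i - ∂_j`. -/
def pdd {d : ℕ} (i j : Fin d) (f : (Fin d → ℝ) → ℝ) : (Fin d → ℝ) → ℝ :=
  fun x => pd i f x - pd j f x

/-- `⟨x,∇⟩ = ∑ x_i ∂_i`. -/
def xgrad {d : ℕ} (f : (Fin d → ℝ) → ℝ) : (Fin d → ℝ) → ℝ :=
  fun x => ∑ i, x i * pd i f x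

/-- The Jacobi weight `W_κ(x) = x_1^{κ_1} ⋯ x_d^{κ_d} (1-|x|)^{κ_{d+1}}`. -/
def Wk {d : ℕ} (κ : Fin (d+1) → ℝ) (x : Fin d → ℝ) : ℝ :=
  (∏ i : Fin d, x i ^ κ i.castSucc) * (1 - ∑ i, x i) ^ κ (Fin.last d)

/-- The spectral operator `D_κ`. -/
def Dk {d : ℕ} (κ : Fin (d+1) → ℝ) (f : (Fin d → ℝ) → ℝ) (x : Fin d → ℝ) : ℝ :=
  (∑ i, x i * (1 - x i) * pd i (pd i f) x)
    - 2 * ∑ i, ∑ j ∈ Finset.univ.filter (fun j => i < j), x i * x j * pd i (pd j f) x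
    + ∑ i, (κ i.castSucc + 1 - ((∑ k, κ k) + (d : ℝ) + 1) * x i) * pd i f x

/-- The normalizing constant `b_κ`. -/
def bk {d : ℕ} (κ : Fin (d+1) → ℝ) : ℝ :=
  Real.Gamma ((∑ i, κ i) + (d : ℝ) + 1) / ∏ i, Real.Gamma (κ i + 1)

/-- The inner product `⟨f,g⟩_κ = b_κ ∫_{△^d} f g W_κ`. -/
def ipk {d : ℕ} (κ : Fin (d+1) → ℝ) (f g : (Fin d → ℝ) → ℝ) : ℝ :=
  bk κ * ∫ x in Splx d, f x * g x * Wk κ x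

/-- The norm `‖f‖_{κ,2}`. -/
def nrm2 {d : ℕ} (κ : Fin (d+1) → ℝ) (f : (Fin d → ℝ) → ℝ) : ℝ :=
  Real.sqrt (ipk κ f f)

/-- Membership in `V_n^d(W_κ)`: a polynomial of degree (at most) `n` orthogonal to all
polynomials of lower degree. -/
def InVn (d n : ℕ) (κ : Fin (d+1) → ℝ) (f : MvPolynomial (Fin d) ℝ) : Prop :=
  f.totalDegree ≤ n ∧ ∀ g : MvPolynomial (Fin d) ℝ, g.totalDegree < n →
    ipk κ (fun x => MvPolynomial.eval x f) (fun x => MvPolynomial.eval x g) = 0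

/-- `x_k` for `1 ≤ k ≤ d+1`, with the convention `x_{d+1} = 1 - |x|`. -/
def xe {d : ℕ} (x : Fin d → ℝ) (k : Fin (d+1)) : ℝ :=
  if h : (k : ℕ) < d then x ⟨(k : ℕ), h⟩ else 1 - ∑ i, x i

/-- The weight `s ^ α * (1 - ρ s) ^ β` that the Jacobi weight of the simplex induces on a ray. -/
def radialWeight (α β ρ s : ℝ) : ℝ := s ^ α * (1 - ρ * s) ^ β

/-- The integral of a polynomial against `radialWeight` over `[0, ρ⁻¹]`. -/
def radialIntegral (α β ρ : ℝ) (p : Polynomial ℝ) : ℝ :=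
  ∫ s in (0 : ℝ)..ρ⁻¹, p.eval s * radialWeight α β ρ s

/-- The Jacobi differential operator that is symmetric for `radialIntegral`. -/
def jacobiOp (α β ρ : ℝ) (p : Polynomial ℝ) : Polynomial ℝ :=
  -(Polynomial.X * (1 - Polynomial.C ρ * Polynomial.X) * p.derivative.derivative +
    (Polynomial.C (α + 1) - Polynomial.C ((α + β + 2) * ρ) * Polynomial.X) * p.derivative)

/-- The Jacobi eigenvalue `t (t + α + β + 1)`. -/
def jacobiEigenvalue (α β t : ℝ) : ℝ := t * (t + α + β + 1)

/-- The coefficients of the eigenpolynomial of degree `n` of `jacobiOp`. -/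
def jacobiCoeff (α β ρ : ℝ) (n k : ℕ) : ℝ :=
  ∏ j ∈ range k, (-(ρ * (jacobiEigenvalue α β n - jacobiEigenvalue α β j)) /
    (((j : ℝ) + 1) * ((j : ℝ) + 1 + α)))

/-- The eigenpolynomial of degree `n` of `jacobiOp`. -/
def jacobiEigenpoly (α β ρ : ℝ) (n : ℕ) : Polynomial ℝ :=
  ∑ k ∈ range (n + 1), Polynomial.monomial k (jacobiCoeff α β ρ n k)

section Radial

variable {α β ρ : ℝ}

lemma radialWeight_nonneg {s : ℝ} (hρ : 0 < ρ) (hs : s ∈ Set.Icc 0 ρ⁻¹) :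
    0 ≤ radialWeight α β ρ s := by
  have h : ρ * s ≤ 1 := by
    simpa [hρ.ne'] using mul_le_mul_of_nonneg_left hs.2 hρ.le
  exact mul_nonneg (Real.rpow_nonneg hs.1 _) (Real.rpow_nonneg (by linarith) _)

lemma continuous_radialWeight (hα : 0 ≤ α) (hβ : 0 ≤ β) : Continuous (radialWeight α β ρ) := by
  unfold radialWeight
  exact (continuous_id.rpow_const fun _ => Or.inr hα).mul
    ((continuous_const.sub (continuous_const.mul continuous_id)).rpow_const fun _ => Or.inr hβ)

lemma continuous_eval_mul_radialWeight (hα : 0 ≤ α) (hβ : 0 ≤ β) (p : Polynomial ℝ) :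
    Continuous fun s => p.eval s * radialWeight α β ρ s :=
  p.continuous.mul (continuous_radialWeight hα hβ)

lemma radialIntegral_add (hα : 0 ≤ α) (hβ : 0 ≤ β) (p q : Polynomial ℝ) :
    radialIntegral α β ρ (p + q) = radialIntegral α β ρ p + radialIntegral α β ρ q := by
  unfold radialIntegral
  rw [← intervalIntegral.integral_add
    ((continuous_eval_mul_radialWeight hα hβ p).intervalIntegrable _ _)
    ((continuous_eval_mul_radialWeight hα hβ q).intervalIntegrable _ _)]
  simp only [Polynomial.eval_add, add_mul]

lemma radialIntegral_C_mul (c : ℝ) (p : Polynomial ℝ) :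
    radialIntegral α β ρ (Polynomial.C c * p) = c * radialIntegral α β ρ p := by
  unfold radialIntegral
  rw [← intervalIntegral.integral_const_mul]
  simp only [Polynomial.eval_mul, Polynomial.eval_C, mul_assoc]

lemma radialIntegral_nonneg (hρ : 0 < ρ) {p : Polynomial ℝ}
    (hp : ∀ s ∈ Set.Icc 0 ρ⁻¹, 0 ≤ p.eval s) : 0 ≤ radialIntegral α β ρ p :=
  intervalIntegral.integral_nonneg (inv_pos.2 hρ).le fun s hs =>
    mul_nonneg (hp s hs) (radialWeight_nonneg hρ hs)

/-- Integration by parts for the radial weight. -/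
lemma radialIntegral_derivative_mul_derivative (hα : 0 ≤ α) (hβ : 0 ≤ β) (hρ : 0 < ρ)
    (p q : Polynomial ℝ) :
    radialIntegral α β ρ (Polynomial.X * (1 - Polynomial.C ρ * Polynomial.X) *
      (p.derivative * q.derivative)) = radialIntegral α β ρ (jacobiOp α β ρ p * q) := by
  have hderiv : ∀ s ∈ Set.uIcc 0 ρ⁻¹, HasDerivAt
      (fun s => radialWeight (α + 1) (β + 1) ρ s * (p.derivative * q).eval s)
      ((Polynomial.X * (1 - Polynomial.C ρ * Polynomial.X) *
        (p.derivative * q.derivative) + Polynomial.C (-1) * (jacobiOp α β ρ p * q)).eval s *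
        radialWeight α β ρ s) s := by
    intro s hs
    rw [Set.uIcc_of_le (inv_pos.2 hρ).le] at hs
    have h : 0 ≤ 1 - ρ * s := by
      have := mul_le_mul_of_nonneg_left hs.2 hρ.le
      rw [mul_inv_cancel₀ hρ.ne'] at this
      linarith
    have h₁ := (hasDerivAt_id s).rpow_const (p := α + 1) (Or.inr (by linarith))
    have h₂ := (((hasDerivAt_id s).const_mul ρ).const_sub 1).rpow_const (p := β + 1)
      (Or.inr (by linarith))
    refine ((h₁.mul h₂).mul ((p.derivative * q).hasDerivAt s)).congr_deriv ?_
    simp only [id_eq, add_sub_cancel_right, Pi.mul_apply, Real.rpow_add_one' hs.1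
      (show α + 1 ≠ 0 by linarith), Real.rpow_add_one' h (show β + 1 ≠ 0 by linarith),
      jacobiOp, radialWeight]
    simp
    ring
  have hint := intervalIntegral.integral_eq_sub_of_hasDerivAt hderiv
    ((continuous_eval_mul_radialWeight hα hβ _).intervalIntegrable _ _)
  have hzero : radialIntegral α β ρ (Polynomial.X * (1 - Polynomial.C ρ * Polynomial.X) *
      (p.derivative * q.derivative) + Polynomial.C (-1) * (jacobiOp α β ρ p * q)) = 0 := by
    rw [radialIntegral, hint]
    simp [radialWeight, hρ.ne', Real.zero_rpow (show α + 1 ≠ 0 by linarith),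
      Real.zero_rpow (show β + 1 ≠ 0 by linarith)]
  rw [radialIntegral_add hα hβ, radialIntegral_C_mul] at hzero
  linarith

lemma radialIntegral_jacobiOp_comm (hα : 0 ≤ α) (hβ : 0 ≤ β) (hρ : 0 < ρ) (p q : Polynomial ℝ) :
    radialIntegral α β ρ (jacobiOp α β ρ p * q) = radialIntegral α β ρ (jacobiOp α β ρ q * p) := by
  rw [← radialIntegral_derivative_mul_derivative hα hβ hρ,
    ← radialIntegral_derivative_mul_derivative hα hβ hρ, mul_comm p.derivative]

lemma jacobiOp_add (p q : Polynomial ℝ) :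
    jacobiOp α β ρ (p + q) = jacobiOp α β ρ p + jacobiOp α β ρ q := by
  simp only [jacobiOp, Polynomial.derivative_add]
  ring

lemma jacobiOp_C_mul (c : ℝ) (p : Polynomial ℝ) :
    jacobiOp α β ρ (Polynomial.C c * p) = Polynomial.C c * jacobiOp α β ρ p := by
  simp only [jacobiOp, Polynomial.derivative_C_mul]
  ring

lemma coeff_jacobiOp (p : Polynomial ℝ) (k : ℕ) :
    (jacobiOp α β ρ p).coeff k = ρ * jacobiEigenvalue α β k * p.coeff k -
      ((k : ℝ) + 1) * ((k : ℝ) + 1 + α) * p.coeff (k + 1) := by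
  have h : jacobiOp α β ρ p = -(Polynomial.X * p.derivative.derivative -
      Polynomial.C ρ * (Polynomial.X * (Polynomial.X * p.derivative.derivative)) +
      Polynomial.C (α + 1) * p.derivative -
      Polynomial.C ((α + β + 2) * ρ) * (Polynomial.X * p.derivative)) := by
    unfold jacobiOp
    ring
  rw [h]
  rcases k with _ | _ | k <;>
    simp only [Polynomial.coeff_neg, Polynomial.coeff_sub, Polynomial.coeff_add,
      Polynomial.coeff_C_mul, Polynomial.coeff_X_mul_zero, Polynomial.coeff_X_mul,
      Polynomial.coeff_derivative, jacobiEigenvalue] <;> push_cast <;> ring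

lemma jacobiEigenvalue_lt (hα : 0 ≤ α) (hβ : 0 ≤ β) {s t : ℝ} (hs : 0 ≤ s) (hst : s < t) :
    jacobiEigenvalue α β s < jacobiEigenvalue α β t := by
  unfold jacobiEigenvalue
  exact mul_lt_mul'' hst (by linarith) hs (by linarith)

lemma jacobiCoeff_eq_zero {n k : ℕ} (h : n < k) : jacobiCoeff α β ρ n k = 0 :=
  prod_eq_zero (mem_range.2 h) (by simp)

lemma jacobiCoeff_self_ne_zero (hα : 0 ≤ α) (hβ : 0 ≤ β) (hρ : 0 < ρ) (n : ℕ) :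
    jacobiCoeff α β ρ n n ≠ 0 := by
  refine prod_ne_zero_iff.2 fun j hj => ?_
  have h := jacobiEigenvalue_lt hα hβ (Nat.cast_nonneg j)
    (Nat.cast_lt (α := ℝ).2 (mem_range.1 hj))
  exact div_ne_zero (neg_ne_zero.2 (mul_ne_zero hρ.ne' (sub_pos.2 h).ne')) (by positivity)

lemma coeff_jacobiEigenpoly (n k : ℕ) :
    (jacobiEigenpoly α β ρ n).coeff k = jacobiCoeff α β ρ n k := by
  simp only [jacobiEigenpoly, Polynomial.finsetSum_coeff, Polynomial.coeff_monomial,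
    sum_ite_eq', mem_range]
  split_ifs with h
  · rfl
  · exact (jacobiCoeff_eq_zero (by omega)).symm

lemma jacobiOp_jacobiEigenpoly (hα : 0 ≤ α) (n : ℕ) :
    jacobiOp α β ρ (jacobiEigenpoly α β ρ n) =
      Polynomial.C (ρ * jacobiEigenvalue α β n) * jacobiEigenpoly α β ρ n := by
  ext k
  rw [coeff_jacobiOp, Polynomial.coeff_C_mul, coeff_jacobiEigenpoly, coeff_jacobiEigenpoly,
    jacobiCoeff, jacobiCoeff, prod_range_succ]
  have : ((k : ℝ) + 1) * ((k : ℝ) + 1 + α) ≠ 0 := by positivity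
  field_simp
  ring

lemma natDegree_jacobiEigenpoly_le (n : ℕ) : (jacobiEigenpoly α β ρ n).natDegree ≤ n := by
  refine Polynomial.natDegree_le_iff_coeff_eq_zero.2 fun k hk => ?_
  rw [coeff_jacobiEigenpoly, jacobiCoeff_eq_zero hk]

lemma radialIntegral_jacobiEigenpoly (hα : 0 ≤ α) (hβ : 0 ≤ β) (hρ : 0 < ρ) (n : ℕ) :
    radialIntegral α β ρ (Polynomial.X * (1 - Polynomial.C ρ * Polynomial.X) *
      ((jacobiEigenpoly α β ρ n).derivative * (jacobiEigenpoly α β ρ n).derivative)) =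
    ρ * jacobiEigenvalue α β n *
      radialIntegral α β ρ (jacobiEigenpoly α β ρ n * jacobiEigenpoly α β ρ n) := by
  rw [radialIntegral_derivative_mul_derivative hα hβ hρ, jacobiOp_jacobiEigenpoly hα, mul_assoc,
    radialIntegral_C_mul]

lemma radialIntegral_jacobiOp_mul_self_le (hα : 0 ≤ α) (hβ : 0 ≤ β) (hρ : 0 < ρ) (n : ℕ) :
    ∀ p : Polynomial ℝ, p.natDegree ≤ n → radialIntegral α β ρ (jacobiOp α β ρ p * p) ≤
      ρ * jacobiEigenvalue α β n * radialIntegral α β ρ (p * p) := by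
  induction n with
  | zero =>
    intro p hp
    rw [Polynomial.eq_C_of_natDegree_le_zero hp]
    simp [jacobiOp, jacobiEigenvalue, radialIntegral]
  | succ n ih =>
    intro p hp
    set P := jacobiEigenpoly α β ρ (n + 1) with hP
    obtain ⟨c, h, rfl, hh⟩ : ∃ c : ℝ, ∃ h : Polynomial ℝ,
        p = Polynomial.C c * P + h ∧ h.natDegree ≤ n := by
      have hne := jacobiCoeff_self_ne_zero hα hβ hρ (n + 1)
      refine ⟨p.coeff (n + 1) / jacobiCoeff α β ρ (n + 1) (n + 1), _,
        (add_sub_cancel _ p).symm, Polynomial.natDegree_le_iff_coeff_eq_zero.2 fun k hk => ?_⟩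
      rw [Polynomial.coeff_sub, Polynomial.coeff_C_mul, hP, coeff_jacobiEigenpoly]
      rcases (Nat.succ_le_of_lt hk).eq_or_lt with rfl | hk'
      · simp [hne]
      · rw [jacobiCoeff_eq_zero hk', Polynomial.natDegree_le_iff_coeff_eq_zero.1 hp k hk']
        simp
    have hmono := mul_le_mul_of_nonneg_right (mul_le_mul_of_nonneg_left
      (jacobiEigenvalue_lt hα hβ (Nat.cast_nonneg n)
        (Nat.cast_lt (α := ℝ).2 n.lt_succ_self)).le hρ.le)
      (radialIntegral_nonneg (α := α) (β := β) hρ (p := h * h)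
        fun s _ => by rw [Polynomial.eval_mul]; exact mul_self_nonneg _)
    have hcross := radialIntegral_jacobiOp_comm hα hβ hρ h P
    have hPP := jacobiOp_jacobiEigenpoly (β := β) (ρ := ρ) hα (n + 1)
    rw [← hP] at hPP
    set μ := ρ * jacobiEigenvalue α β ((n + 1 : ℕ) : ℝ)
    have hl : jacobiOp α β ρ (Polynomial.C c * P + h) * (Polynomial.C c * P + h) =
        Polynomial.C (c * c * μ) * (P * P) + (Polynomial.C (c * μ) * (P * h) +
          (Polynomial.C c * (jacobiOp α β ρ h * P) + jacobiOp α β ρ h * h)) := by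
      rw [jacobiOp_add, jacobiOp_C_mul, hPP]
      simp only [Polynomial.C_mul]
      ring
    have hr : (Polynomial.C c * P + h) * (Polynomial.C c * P + h) =
        Polynomial.C (c * c) * (P * P) + (Polynomial.C (2 * c) * (P * h) + h * h) := by
      simp only [Polynomial.C_mul, map_ofNat]
      ring
    rw [hPP, mul_assoc, radialIntegral_C_mul] at hcross
    rw [hl, hr]
    simp only [radialIntegral_add hα hβ, radialIntegral_C_mul, hcross]
    have := ih h hh
    linarith

end Radial

section Polar

variable {d : ℕ}

lemma isCompact_Splx : IsCompact (Splx d) := by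
  refine isCompact_Icc.of_isClosed_subset (s := Set.Icc (0 : Fin d → ℝ) 1) ?_ fun x hx =>
    ⟨hx.1, fun i => (single_le_sum (fun j _ => hx.1 j) (mem_univ i)).trans hx.2⟩
  change IsClosed ({x : Fin d → ℝ | ∀ i, 0 ≤ x i} ∩ {x | ∑ i, x i ≤ 1})
  exact isClosed_Ici.inter (isClosed_le (by fun_prop) continuous_const)

lemma smul_mem_Splx_iff {ω : Fin d → ℝ} (hω : ∀ i, 0 ≤ ω i) (hρ : 0 < ∑ i, ω i) {s : ℝ}
    (hs : 0 < s) : s • ω ∈ Splx d ↔ s ≤ (∑ i, ω i)⁻¹ := by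
  simp only [Splx, Set.mem_ofPred_eq, Pi.smul_apply, smul_eq_mul, ← mul_sum, ← one_div, le_div_iff₀ hρ, and_iff_right_iff_imp]
  exact fun _ i => mul_nonneg hs.le (hω i)

/-- Integration in polar coordinates over the sphere of the sup norm. -/
lemma lintegral_eq_lintegral_sphere_lintegral_Ioi {F : (Fin d → ℝ) → ENNReal}
    (hF : Measurable F) (hd : d ≠ 0) :
    ∫⁻ x, F x = ∫⁻ ω : Metric.sphere (0 : Fin d → ℝ) 1, ∫⁻ s in Set.Ioi (0 : ℝ),
      F (s • (ω : Fin d → ℝ)) * ENNReal.ofReal (s ^ (d - 1)) ∂volume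
        ∂(volume : Measure (Fin d → ℝ)).toSphere := by
  have : NeZero d := ⟨hd⟩
  have hpolar := (Measure.measurePreserving_homeomorphUnitSphereProd
    (volume : Measure (Fin d → ℝ))).lintegral_comp_emb
      (Homeomorph.measurableEmbedding _) fun z => F ((z.2 : ℝ) • (z.1 : Fin d → ℝ))
  have hinv : ∀ x : ({0}ᶜ : Set (Fin d → ℝ)),
      (((homeomorphUnitSphereProd (Fin d → ℝ)) x).2 : ℝ) •
        (((homeomorphUnitSphereProd (Fin d → ℝ)) x).1 : Fin d → ℝ) = x := fun x => by
    rw [← homeomorphUnitSphereProd_symm_apply_coe, Homeomorph.symm_apply_apply]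
  simp only [hinv] at hpolar
  rw [lintegral_subtype_comap (measurableSet_singleton _).compl F, restrict_compl_singleton]
    at hpolar
  rw [hpolar, lintegral_prod _ (by fun_prop)]
  refine lintegral_congr fun ω => ?_
  rw [Measure.volumeIoiPow, lintegral_withDensity_eq_lintegral_mul _ (by fun_prop) (by fun_prop),
    ← lintegral_subtype_comap measurableSet_Ioi]
  refine lintegral_congr fun s => ?_
  simp [mul_comm]

lemma setLIntegral_Splx {F : (Fin d → ℝ) → ENNReal} (hF : Measurable F) (hd : d ≠ 0) :
    ∫⁻ x in Splx d, F x = ∫⁻ ω : Metric.sphere (0 : Fin d → ℝ) 1, ∫⁻ s in Set.Ioi (0 : ℝ),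
      (Splx d).indicator F (s • (ω : Fin d → ℝ)) * ENNReal.ofReal (s ^ (d - 1)) ∂volume
        ∂(volume : Measure (Fin d → ℝ)).toSphere := by
  rw [← lintegral_indicator isCompact_Splx.measurableSet,
    lintegral_eq_lintegral_sphere_lintegral_Ioi (hF.indicator isCompact_Splx.measurableSet) hd]

lemma lintegral_ray_of_neg {F : (Fin d → ℝ) → ENNReal} {ω : Fin d → ℝ} {i : Fin d}
    (hi : ω i < 0) : ∫⁻ s in Set.Ioi (0 : ℝ),
      (Splx d).indicator F (s • ω) * ENNReal.ofReal (s ^ (d - 1)) = 0 := by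
  rw [setLIntegral_congr_fun (g := 0) measurableSet_Ioi fun s hs => ?_]
  · simp
  · have : s • ω ∉ Splx d := fun h => (h.1 i).not_gt (mul_neg_of_pos_of_neg hs hi)
    simp [Set.indicator_of_notMem this]

lemma lintegral_ray {α β : ℝ} (hα : 0 ≤ α) (hβ : 0 ≤ β) {G : (Fin d → ℝ) → ℝ} {ω : Fin d → ℝ}
    (hω : ∀ i, 0 ≤ ω i) (hρ : 0 < ∑ i, ω i) {c : ℝ} (hc : 0 ≤ c) {q : Polynomial ℝ}
    (hq : ∀ s ∈ Set.Icc 0 (∑ i, ω i)⁻¹, 0 ≤ q.eval s)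
    (hG : ∀ s ∈ Set.Ioc 0 (∑ i, ω i)⁻¹,
      G (s • ω) * s ^ (d - 1) = c * (q.eval s * radialWeight α β (∑ i, ω i) s)) :
    ∫⁻ s in Set.Ioi (0 : ℝ), (Splx d).indicator (fun x => ENNReal.ofReal (G x)) (s • ω) *
      ENNReal.ofReal (s ^ (d - 1)) = ENNReal.ofReal (c * radialIntegral α β (∑ i, ω i) q) := by
  rw [radialIntegral, ← intervalIntegral.integral_const_mul,
    intervalIntegral.integral_of_le (inv_pos.2 hρ).le,
    ofReal_integral_eq_lintegral_ofReal
      (((continuous_eval_mul_radialWeight hα hβ q).const_mul c).intervalIntegrable _ _).1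
      ((ae_restrict_mem measurableSet_Ioc).mono fun s hs => mul_nonneg hc
        (mul_nonneg (hq s ⟨hs.1.le, hs.2⟩) (radialWeight_nonneg hρ ⟨hs.1.le, hs.2⟩))),
    ← lintegral_indicator measurableSet_Ioi, ← lintegral_indicator measurableSet_Ioc]
  refine lintegral_congr fun s => ?_
  by_cases hs : 0 < s
  · rw [Set.indicator_of_mem (Set.mem_Ioi.2 hs)]
    by_cases hs' : s ≤ (∑ i, ω i)⁻¹
    · rw [Set.indicator_of_mem ((smul_mem_Splx_iff hω hρ hs).2 hs'),
        Set.indicator_of_mem (Set.mem_Ioc.2 ⟨hs, hs'⟩), ← hG s ⟨hs, hs'⟩,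
        ENNReal.ofReal_mul' (pow_nonneg hs.le _)]
    · rw [Set.indicator_of_notMem (mt (smul_mem_Splx_iff hω hρ hs).1 hs'), zero_mul,
        Set.indicator_of_notMem (fun h => hs' h.2)]
  · rw [Set.indicator_of_notMem (mt Set.mem_Ioi.1 hs), Set.indicator_of_notMem (fun h => hs h.1)]

/-- The restriction of a polynomial to the line spanned by `ω`. -/
def rayPoly (f : MvPolynomial (Fin d) ℝ) (ω : Fin d → ℝ) : Polynomial ℝ :=
  MvPolynomial.aeval (fun i => Polynomial.C (ω i) * Polynomial.X) f

lemma eval_rayPoly (f : MvPolynomial (Fin d) ℝ) (ω : Fin d → ℝ) (s : ℝ) :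
    (rayPoly f ω).eval s = MvPolynomial.eval (s • ω) f := by
  induction f using MvPolynomial.induction_on with
  | C a => simp [rayPoly]
  | add p q hp hq => simp_all [rayPoly]
  | mul_X p i hp =>
    simp only [rayPoly] at hp ⊢
    simp [hp, mul_comm s]

lemma natDegree_rayPoly_le {f : MvPolynomial (Fin d) ℝ} {n : ℕ} (hf : f.totalDegree ≤ n)
    (ω : Fin d → ℝ) : (rayPoly f ω).natDegree ≤ n := by
  simpa [rayPoly] using MvPolynomial.aeval_natDegree_le f hf _
    fun i => (Polynomial.natDegree_C_mul_le (ω i) _).trans Polynomial.natDegree_X_le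

lemma contDiff_eval (f : MvPolynomial (Fin d) ℝ) :
    ContDiff ℝ 1 fun x : Fin d → ℝ => MvPolynomial.eval x f :=
  (AnalyticOnNhd.eval_mvPolynomial f).contDiff

lemma xgrad_smul (f : MvPolynomial (Fin d) ℝ) (ω : Fin d → ℝ) (s : ℝ) :
    xgrad (fun y => MvPolynomial.eval y f) (s • ω) = s * (rayPoly f ω).derivative.eval s := by
  have hf := ((contDiff_eval f).differentiable one_ne_zero (s • ω)).hasFDerivAt
  have h₁ := hf.comp_hasDerivAt s ((hasDerivAt_id s).smul_const ω)
  have h₂ := h₁.unique (((rayPoly f ω).hasDerivAt s).congr_of_eventuallyEq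
    (Filter.Eventually.of_forall fun t => (eval_rayPoly f ω t).symm))
  have hsum := congrArg (fderiv ℝ (fun x => MvPolynomial.eval x f) (s • ω)) (pi_eq_sum_univ' ω)
  rw [← h₂, one_smul, hsum, map_sum, mul_sum]
  refine sum_congr rfl fun i _ => ?_
  rw [map_smul]
  simp only [pd, Pi.smul_apply, smul_eq_mul, mul_assoc]

lemma Wk_smul {κ : Fin (d + 1) → ℝ} {ω : Fin d → ℝ} (hω : ∀ i, 0 ≤ ω i)
    {s : ℝ} (hs : 0 < s) : Wk κ (s • ω) * s ^ (d - 1) = (∏ i, ω i ^ κ i.castSucc) *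
      radialWeight (∑ i : Fin d, κ i.castSucc + (d - 1 : ℕ)) (κ (Fin.last d)) (∑ i, ω i) s := by
  have : ∏ i : Fin d, s ^ κ i.castSucc = s ^ ∑ i : Fin d, κ i.castSucc :=
    (Real.rpow_sum_of_pos hs _ _).symm
  simp only [Wk, radialWeight, Pi.smul_apply, smul_eq_mul, ← mul_sum,
    Real.mul_rpow hs.le (hω _), prod_mul_distrib, this, Real.rpow_add hs, Real.rpow_natCast,
    mul_comm s (∑ i, ω i)]
  ring

lemma Wk_nonneg {κ : Fin (d + 1) → ℝ} {x : Fin d → ℝ} (hx : x ∈ Splx d) : 0 ≤ Wk κ x :=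
  mul_nonneg (prod_nonneg fun i _ => Real.rpow_nonneg (hx.1 i) _)
    (Real.rpow_nonneg (sub_nonneg.2 hx.2) _)

lemma continuous_Wk {κ : Fin (d + 1) → ℝ} (hκ : ∀ i, 0 ≤ κ i) :
    Continuous (Wk κ : (Fin d → ℝ) → ℝ) := by
  unfold Wk
  exact (continuous_finsetProd _ fun i _ => (continuous_apply i).rpow_const
    fun _ => Or.inr (hκ _)).mul ((continuous_const.sub (by fun_prop)).rpow_const
      fun _ => Or.inr (hκ _))

lemma measurable_xgrad (f : (Fin d → ℝ) → ℝ) : Measurable (xgrad f) := by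
  unfold xgrad pd
  exact Finset.measurable_fun_sum _ fun i _ =>
    (measurable_pi_apply i).mul (measurable_fderiv_apply_const ℝ f _)

/-- The integrand of the squared norm of the weighted radial derivative. -/
def radialEnergy (κ : Fin (d + 1) → ℝ) (f : MvPolynomial (Fin d) ℝ) (x : Fin d → ℝ) : ℝ :=
  Real.sqrt ((1 - ∑ k, x k) / (∑ k, x k)) * xgrad (fun y => MvPolynomial.eval y f) x *
    (Real.sqrt ((1 - ∑ k, x k) / (∑ k, x k)) * xgrad (fun y => MvPolynomial.eval y f) x) * Wk κ x

/-- The integrand of the squared norm of a polynomial. -/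
def massDensity (κ : Fin (d + 1) → ℝ) (f : MvPolynomial (Fin d) ℝ) (x : Fin d → ℝ) : ℝ :=
  MvPolynomial.eval x f * MvPolynomial.eval x f * Wk κ x

lemma radialEnergy_nonneg {κ : Fin (d + 1) → ℝ} (f : MvPolynomial (Fin d) ℝ) {x : Fin d → ℝ}
    (hx : x ∈ Splx d) : 0 ≤ radialEnergy κ f x :=
  mul_nonneg (mul_self_nonneg _) (Wk_nonneg hx)

lemma massDensity_nonneg {κ : Fin (d + 1) → ℝ} (f : MvPolynomial (Fin d) ℝ) {x : Fin d → ℝ}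
    (hx : x ∈ Splx d) : 0 ≤ massDensity κ f x :=
  mul_nonneg (mul_self_nonneg _) (Wk_nonneg hx)

lemma continuous_massDensity {κ : Fin (d + 1) → ℝ} (hκ : ∀ i, 0 ≤ κ i)
    (f : MvPolynomial (Fin d) ℝ) : Continuous (massDensity κ f) :=
  ((contDiff_eval f).continuous.mul (contDiff_eval f).continuous).mul (continuous_Wk hκ)

lemma measurable_radialEnergy {κ : Fin (d + 1) → ℝ} (hκ : ∀ i, 0 ≤ κ i)
    (f : MvPolynomial (Fin d) ℝ) : Measurable (radialEnergy κ f) := by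
  have h : Measurable fun x : Fin d → ℝ =>
      Real.sqrt ((1 - ∑ k, x k) / (∑ k, x k)) * xgrad (fun y => MvPolynomial.eval y f) x :=
    (by fun_prop : Measurable fun x : Fin d → ℝ =>
      Real.sqrt ((1 - ∑ k, x k) / (∑ k, x k))).mul (measurable_xgrad _)
  exact (h.mul h).mul (continuous_Wk hκ).measurable

lemma lintegral_ray_massDensity {κ : Fin (d + 1) → ℝ} (hκ : ∀ i, 0 ≤ κ i)
    (f : MvPolynomial (Fin d) ℝ) {ω : Fin d → ℝ} (hω : ∀ i, 0 ≤ ω i) (hρ : 0 < ∑ i, ω i) :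
    ∫⁻ s in Set.Ioi (0 : ℝ), (Splx d).indicator (fun x => ENNReal.ofReal (massDensity κ f x))
      (s • ω) * ENNReal.ofReal (s ^ (d - 1)) = ENNReal.ofReal ((∏ i, ω i ^ κ i.castSucc) *
        radialIntegral (∑ i : Fin d, κ i.castSucc + (d - 1 : ℕ)) (κ (Fin.last d)) (∑ i, ω i)
          (rayPoly f ω * rayPoly f ω)) := by
  refine lintegral_ray (add_nonneg (sum_nonneg fun i _ => hκ _) (Nat.cast_nonneg _)) (hκ _) hω hρ
    (prod_nonneg fun i _ => Real.rpow_nonneg (hω i) _) (fun s _ => ?_) fun s hs => ?_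
  · rw [Polynomial.eval_mul]
    exact mul_self_nonneg _
  · rw [massDensity, mul_assoc, Wk_smul hω hs.1, Polynomial.eval_mul, eval_rayPoly]
    ring

lemma lintegral_ray_radialEnergy {κ : Fin (d + 1) → ℝ} (hκ : ∀ i, 0 ≤ κ i)
    (f : MvPolynomial (Fin d) ℝ) {ω : Fin d → ℝ} (hω : ∀ i, 0 ≤ ω i) (hρ : 0 < ∑ i, ω i) :
    ∫⁻ s in Set.Ioi (0 : ℝ), (Splx d).indicator (fun x => ENNReal.ofReal (radialEnergy κ f x))
      (s • ω) * ENNReal.ofReal (s ^ (d - 1)) =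
        ENNReal.ofReal ((∏ i, ω i ^ κ i.castSucc) * (∑ i, ω i)⁻¹ *
        radialIntegral (∑ i : Fin d, κ i.castSucc + (d - 1 : ℕ)) (κ (Fin.last d)) (∑ i, ω i)
          (Polynomial.X * (1 - Polynomial.C (∑ i, ω i) * Polynomial.X) *
            ((rayPoly f ω).derivative * (rayPoly f ω).derivative))) := by
  have hle : ∀ s ≤ (∑ i, ω i)⁻¹, 0 ≤ 1 - (∑ i, ω i) * s := fun s hs => by
    have := mul_le_mul_of_nonneg_left hs hρ.le
    rw [mul_inv_cancel₀ hρ.ne'] at this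
    linarith
  refine lintegral_ray (add_nonneg (sum_nonneg fun i _ => hκ _) (Nat.cast_nonneg _)) (hκ _) hω hρ
    (mul_nonneg (prod_nonneg fun i _ => Real.rpow_nonneg (hω i) _) (inv_pos.2 hρ).le)
    (fun s hs => ?_) fun s hs => ?_
  · simp only [Polynomial.eval_mul, Polynomial.eval_X, Polynomial.eval_sub, Polynomial.eval_one,
      Polynomial.eval_C]
    exact mul_nonneg (mul_nonneg hs.1 (hle s hs.2)) (mul_self_nonneg _)
  · have hs₀ : s ≠ 0 := hs.1.ne'
    rw [radialEnergy, mul_assoc, Wk_smul hω hs.1, xgrad_smul, mul_mul_mul_comm (√_) _ (√_),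
      Real.mul_self_sqrt]
    · simp only [Pi.smul_apply, smul_eq_mul, ← mul_sum, Polynomial.eval_mul, Polynomial.eval_X,
        Polynomial.eval_sub, Polynomial.eval_one, Polynomial.eval_C]
      field_simp
    · simp only [Pi.smul_apply, smul_eq_mul, ← mul_sum]
      rw [mul_comm s]
      exact div_nonneg (hle s hs.2) (mul_nonneg hρ.le hs.1.le)

lemma sum_pos_of_mem_sphere {ω : Fin d → ℝ} (h : ω ∈ Metric.sphere (0 : Fin d → ℝ) 1)
    (hω : ∀ i, 0 ≤ ω i) : 0 < ∑ i, ω i := by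
  refine (sum_nonneg fun i _ => hω i).lt_of_ne' fun h₀ => ne_zero_of_mem_unit_sphere ⟨ω, h⟩ ?_
  exact funext fun i => (sum_eq_zero_iff_of_nonneg fun i _ => hω i).1 h₀ i (mem_univ i)

lemma jacobiEigenvalue_simplex (hd : d ≠ 0) (κ : Fin (d + 1) → ℝ) (n : ℕ) :
    jacobiEigenvalue (∑ i : Fin d, κ i.castSucc + (d - 1 : ℕ)) (κ (Fin.last d)) n =
      (n : ℝ) * ((n : ℝ) + (∑ k, κ k) + (d : ℝ)) := by
  rw [jacobiEigenvalue, Fin.sum_univ_castSucc, Nat.cast_pred (Nat.pos_of_ne_zero hd)]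
  ring

lemma setLIntegral_radialEnergy_le (hd : d ≠ 0) {κ : Fin (d + 1) → ℝ} (hκ : ∀ i, 0 ≤ κ i)
    {n : ℕ} {f : MvPolynomial (Fin d) ℝ} (hf : f.totalDegree ≤ n) :
    ∫⁻ x in Splx d, ENNReal.ofReal (radialEnergy κ f x) ≤
      ENNReal.ofReal ((n : ℝ) * ((n : ℝ) + (∑ k, κ k) + (d : ℝ))) *
        ∫⁻ x in Splx d, ENNReal.ofReal (massDensity κ f x) := by
  have hl : 0 ≤ (n : ℝ) * ((n : ℝ) + (∑ k, κ k) + (d : ℝ)) := by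
    have := sum_nonneg fun k (_ : k ∈ univ) => hκ k
    positivity
  rw [setLIntegral_Splx (measurable_radialEnergy hκ f).ennreal_ofReal hd,
    setLIntegral_Splx (continuous_massDensity hκ f).measurable.ennreal_ofReal hd,
    ← lintegral_const_mul' _ _ ENNReal.ofReal_ne_top]
  refine lintegral_mono fun ω => ?_
  by_cases hω : ∀ i, 0 ≤ (ω : Fin d → ℝ) i
  · have hρ := sum_pos_of_mem_sphere ω.2 hω
    have hα : 0 ≤ ∑ i : Fin d, κ i.castSucc + ((d - 1 : ℕ) : ℝ) :=
      add_nonneg (sum_nonneg fun i _ => hκ _) (Nat.cast_nonneg _)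
    have hle := radialIntegral_jacobiOp_mul_self_le hα (hκ (Fin.last d)) hρ n _
      (natDegree_rayPoly_le hf ω)
    rw [← radialIntegral_derivative_mul_derivative hα (hκ _) hρ, jacobiEigenvalue_simplex hd]
      at hle
    have hc : 0 ≤ ∏ i, (ω : Fin d → ℝ) i ^ κ i.castSucc :=
      prod_nonneg fun i _ => Real.rpow_nonneg (hω i) _
    simp only []
    rw [lintegral_ray_radialEnergy hκ f hω hρ, lintegral_ray_massDensity hκ f hω hρ,
      ← ENNReal.ofReal_mul hl]
    refine ENNReal.ofReal_le_ofReal ((mul_le_mul_of_nonneg_left hle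
      (mul_nonneg hc (inv_pos.2 hρ).le)).trans_eq ?_)
    field_simp
  · obtain ⟨i, hi⟩ := not_forall.1 hω
    simp only [lintegral_ray_of_neg (not_le.1 hi), mul_zero, le_refl]

/-- The polynomial of degree `n` in `x_1 + ⋯ + x_d` attaining equality. -/
def extremalPoly (κ : Fin (d + 1) → ℝ) (n : ℕ) : MvPolynomial (Fin d) ℝ :=
  Polynomial.aeval (∑ i, MvPolynomial.X i)
    (jacobiEigenpoly (∑ i : Fin d, κ i.castSucc + (d - 1 : ℕ)) (κ (Fin.last d)) 1 n)

lemma jacobiCoeff_eq_pow_mul {α β ρ : ℝ} (n k : ℕ) :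
    jacobiCoeff α β ρ n k = ρ ^ k * jacobiCoeff α β 1 n k := by
  have h : ρ ^ k = ∏ _j ∈ range k, ρ := by rw [prod_const, card_range]
  rw [jacobiCoeff, jacobiCoeff, h, ← prod_mul_distrib]
  exact prod_congr rfl fun j _ => by ring

lemma rayPoly_extremalPoly (κ : Fin (d + 1) → ℝ) (n : ℕ) (ω : Fin d → ℝ) :
    rayPoly (extremalPoly κ n) ω = jacobiEigenpoly
      (∑ i : Fin d, κ i.castSucc + (d - 1 : ℕ)) (κ (Fin.last d)) (∑ i, ω i) n := by
  rw [rayPoly, extremalPoly, ← Polynomial.aeval_algHom_apply]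
  simp only [jacobiEigenpoly, map_sum, MvPolynomial.aeval_X, ← sum_mul, Polynomial.aeval_monomial]
  refine sum_congr rfl fun k _ => ?_
  rw [jacobiCoeff_eq_pow_mul (ρ := ∑ i, ω i), ← Polynomial.C_mul_X_pow_eq_monomial, mul_pow,
    Polynomial.C_mul, Polynomial.C_pow, map_sum, Polynomial.algebraMap_eq]
  ring

lemma totalDegree_extremalPoly (hd : d ≠ 0) {κ : Fin (d + 1) → ℝ} (hκ : ∀ i, 0 ≤ κ i) (n : ℕ) :
    extremalPoly κ n ≠ 0 ∧ (extremalPoly κ n).totalDegree = n := by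
  have hα : 0 ≤ ∑ i : Fin d, κ i.castSucc + ((d - 1 : ℕ) : ℝ) :=
    add_nonneg (sum_nonneg fun i _ => hκ _) (Nat.cast_nonneg _)
  have hρ : 0 < ∑ _i : Fin d, (1 : ℝ) := by
    simpa using Nat.pos_of_ne_zero hd
  have hcoeff : (rayPoly (extremalPoly κ n) fun _ => 1).coeff n ≠ 0 := by
    rw [rayPoly_extremalPoly, coeff_jacobiEigenpoly]
    exact jacobiCoeff_self_ne_zero hα (hκ _) hρ n
  refine ⟨fun h => hcoeff (by simp [h, rayPoly]), le_antisymm ?_ ?_⟩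
  · rw [extremalPoly, jacobiEigenpoly, map_sum]
    refine MvPolynomial.totalDegree_finsetSum_le fun k hk => ?_
    rw [Polynomial.aeval_monomial, MvPolynomial.algebraMap_eq, ← MvPolynomial.smul_eq_C_mul]
    refine (MvPolynomial.totalDegree_smul_le _ _).trans ((MvPolynomial.totalDegree_pow _ _).trans ?_)
    have : (∑ i : Fin d, (MvPolynomial.X i : MvPolynomial (Fin d) ℝ)).totalDegree ≤ 1 :=
      MvPolynomial.totalDegree_finsetSum_le fun i _ => (MvPolynomial.totalDegree_X i).le
    exact (Nat.mul_le_mul_left k this).trans (by have := mem_range.1 hk; omega)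
  · exact (Polynomial.le_natDegree_of_ne_zero hcoeff).trans (natDegree_rayPoly_le le_rfl _)

lemma setLIntegral_radialEnergy_extremalPoly (hd : d ≠ 0) {κ : Fin (d + 1) → ℝ}
    (hκ : ∀ i, 0 ≤ κ i) (n : ℕ) :
    ∫⁻ x in Splx d, ENNReal.ofReal (radialEnergy κ (extremalPoly κ n) x) =
      ENNReal.ofReal ((n : ℝ) * ((n : ℝ) + (∑ k, κ k) + (d : ℝ))) *
        ∫⁻ x in Splx d, ENNReal.ofReal (massDensity κ (extremalPoly κ n) x) := by
  have hl : 0 ≤ (n : ℝ) * ((n : ℝ) + (∑ k, κ k) + (d : ℝ)) := by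
    have := sum_nonneg fun k (_ : k ∈ univ) => hκ k
    positivity
  rw [setLIntegral_Splx (measurable_radialEnergy hκ _).ennreal_ofReal hd,
    setLIntegral_Splx (continuous_massDensity hκ _).measurable.ennreal_ofReal hd,
    ← lintegral_const_mul' _ _ ENNReal.ofReal_ne_top]
  refine lintegral_congr fun ω => ?_
  by_cases hω : ∀ i, 0 ≤ (ω : Fin d → ℝ) i
  · have hρ := sum_pos_of_mem_sphere ω.2 hω
    have hα : 0 ≤ ∑ i : Fin d, κ i.castSucc + ((d - 1 : ℕ) : ℝ) :=
      add_nonneg (sum_nonneg fun i _ => hκ _) (Nat.cast_nonneg _)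
    rw [lintegral_ray_radialEnergy hκ _ hω hρ, lintegral_ray_massDensity hκ _ hω hρ,
      ← ENNReal.ofReal_mul hl, rayPoly_extremalPoly,
      radialIntegral_jacobiEigenpoly hα (hκ _) hρ, jacobiEigenvalue_simplex hd]
    congr 1
    field_simp
  · obtain ⟨i, hi⟩ := not_forall.1 hω
    simp only [lintegral_ray_of_neg (not_le.1 hi), mul_zero]

lemma setIntegral_Splx_eq_toReal {G : (Fin d → ℝ) → ℝ} (hG : Measurable G)
    (hnonneg : ∀ x ∈ Splx d, 0 ≤ G x) :
    ∫ x in Splx d, G x = (∫⁻ x in Splx d, ENNReal.ofReal (G x)).toReal :=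
  integral_eq_lintegral_of_nonneg_ae
    ((ae_restrict_mem isCompact_Splx.measurableSet).mono hnonneg) hG.aestronglyMeasurable

lemma setIntegral_radialEnergy_le (hd : d ≠ 0) {κ : Fin (d + 1) → ℝ} (hκ : ∀ i, 0 ≤ κ i)
    {n : ℕ} {f : MvPolynomial (Fin d) ℝ} (hf : f.totalDegree ≤ n) :
    ∫ x in Splx d, radialEnergy κ f x ≤
      (n : ℝ) * ((n : ℝ) + (∑ k, κ k) + (d : ℝ)) * ∫ x in Splx d, massDensity κ f x := by
  have hl : 0 ≤ (n : ℝ) * ((n : ℝ) + (∑ k, κ k) + (d : ℝ)) := by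
    have := sum_nonneg fun k (_ : k ∈ univ) => hκ k
    positivity
  have hfin : ∫⁻ x in Splx d, ENNReal.ofReal (massDensity κ f x) ≠ ⊤ :=
    ((continuous_massDensity hκ f).continuousOn.integrableOn_compact
      isCompact_Splx).lintegral_lt_top.ne
  rw [setIntegral_Splx_eq_toReal (measurable_radialEnergy hκ f) fun x => radialEnergy_nonneg f,
    setIntegral_Splx_eq_toReal (continuous_massDensity hκ f).measurable
      fun x => massDensity_nonneg f]
  refine (ENNReal.toReal_mono (ENNReal.mul_ne_top ENNReal.ofReal_ne_top hfin)
    (setLIntegral_radialEnergy_le hd hκ hf)).trans_eq ?_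
  rw [ENNReal.toReal_mul, ENNReal.toReal_ofReal hl]

lemma setIntegral_radialEnergy_extremalPoly (hd : d ≠ 0) {κ : Fin (d + 1) → ℝ}
    (hκ : ∀ i, 0 ≤ κ i) (n : ℕ) :
    ∫ x in Splx d, radialEnergy κ (extremalPoly κ n) x =
      (n : ℝ) * ((n : ℝ) + (∑ k, κ k) + (d : ℝ)) *
        ∫ x in Splx d, massDensity κ (extremalPoly κ n) x := by
  have hl : 0 ≤ (n : ℝ) * ((n : ℝ) + (∑ k, κ k) + (d : ℝ)) := by
    have := sum_nonneg fun k (_ : k ∈ univ) => hκ k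
    positivity
  rw [setIntegral_Splx_eq_toReal (measurable_radialEnergy hκ _) fun x => radialEnergy_nonneg _,
    setIntegral_Splx_eq_toReal (continuous_massDensity hκ _).measurable
      fun x => massDensity_nonneg _,
    setLIntegral_radialEnergy_extremalPoly hd hκ, ENNReal.toReal_mul, ENNReal.toReal_ofReal hl]

lemma bk_nonneg {κ : Fin (d + 1) → ℝ} (hκ : ∀ i, 0 ≤ κ i) : 0 ≤ bk κ := by
  have := sum_nonneg fun k (_ : k ∈ univ) => hκ k
  exact div_nonneg (Real.Gamma_pos_of_pos (by positivity)).le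
    (prod_nonneg fun i _ => (Real.Gamma_pos_of_pos (by linarith [hκ i])).le)

end Polar

/-- the sharp inequality \eqref{eq:B-ineq1a}. -/
theorem stmt12 (d : ℕ) (hd : 2 ≤ d) (κ : Fin (d+1) → ℝ) (hκ : ∀ i, 0 ≤ κ i) (n : ℕ) :
    (∀ f : MvPolynomial (Fin d) ℝ, f.totalDegree ≤ n →
      nrm2 κ (fun x => Real.sqrt ((1 - ∑ k, x k) / (∑ k, x k)) *
          xgrad (fun y => MvPolynomial.eval y f) x) ≤
        Real.sqrt ((n : ℝ) * ((n : ℝ) + (∑ k, κ k) + (d : ℝ))) *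
          nrm2 κ (fun x => MvPolynomial.eval x f)) ∧
    (∃ f : MvPolynomial (Fin d) ℝ, f ≠ 0 ∧ f.totalDegree = n ∧
      nrm2 κ (fun x => Real.sqrt ((1 - ∑ k, x k) / (∑ k, x k)) *
          xgrad (fun y => MvPolynomial.eval y f) x) =
        Real.sqrt ((n : ℝ) * ((n : ℝ) + (∑ k, κ k) + (d : ℝ))) *
          nrm2 κ (fun x => MvPolynomial.eval x f)) := by
  have hd₀ : d ≠ 0 := by omega
  have hl : 0 ≤ (n : ℝ) * ((n : ℝ) + (∑ k, κ k) + (d : ℝ)) := by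
    have := sum_nonneg fun k (_ : k ∈ univ) => hκ k
    positivity
  refine ⟨fun f hf => ?_, extremalPoly κ n, (totalDegree_extremalPoly hd₀ hκ n).1,
    (totalDegree_extremalPoly hd₀ hκ n).2, ?_⟩ <;> rw [nrm2, nrm2, ← Real.sqrt_mul hl]
  · refine Real.sqrt_le_sqrt ((mul_le_mul_of_nonneg_left
      (setIntegral_radialEnergy_le hd₀ hκ hf) (bk_nonneg hκ)).trans_eq ?_)
    exact mul_left_comm _ _ _
  · exact congrArg Real.sqrt ((congrArg (bk κ * ·)
      (setIntegral_radialEnergy_extremalPoly hd₀ hκ n)).trans (mul_left_comm _ _ _))
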